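/- arXiv:1902.09877 — 4 statements merged into one kernel-verified Lean document; each statement's English description precedes it below -/
import Mathlib

section
/- For every natural number N ≥ 1 and every N-element point set P in [0,1]: the Lebesgue measure of {t ∈ [0,1] : |D_P(t)| < α} equals the Lebesgue measure of {t ∈ [0,1] : |D_{Γ_N}(t)| < α} for all α > 0 if and only if P = Γ_N. -/
open MeasureTheory Set

/-- One-parameter discrepancy function of the point set `x₀, …, x_{N-1}`. -/
noncomputable def disc (N : ℕ) (x : Fin N → ℝ) (t : ℝ) : ℝ :=
  (∑ n : Fin N, (Set.Ico (0:ℝ) t).indicator (fun _ => (1:ℝ)) (x n)) - N * t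

/-- The centered regular grid Γ_N. -/
noncomputable def grid (N : ℕ) : Fin N → ℝ := fun n => (2 * (n : ℝ) + 1) / (2 * N)

theorem disc_eq_ncard {N : ℕ} {x : Fin N → ℝ} (hx : ∀ n, 0 ≤ x n) (t : ℝ) :
    disc N x t = ({n | x n < t} : Set (Fin N)).ncard - N * t := by
  classical
  have h : ({n | x n < t} : Set (Fin N)) = ↑(Finset.univ.filter fun n => x n < t) := by
    ext; simp
  rw [disc, h, Set.ncard_coe_finset, Finset.card_filter]
  simp [Set.indicator_apply, hx]

theorem succ_le_ncard_lt {N : ℕ} {x : Fin N → ℝ} (hmono : Monotone x) {n : Fin N} {t : ℝ}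
    (h : x n < t) : (n : ℕ) + 1 ≤ ({m | x m < t} : Set (Fin N)).ncard := by
  have hsub : (Finset.Iic n : Set (Fin N)) ⊆ {m | x m < t} := fun m hm =>
    (hmono (by simpa using hm)).trans_lt h
  have hcard := Set.ncard_le_ncard hsub (Set.toFinite _)
  rwa [Set.ncard_coe_finset, Fin.card_Iic] at hcard

theorem ncard_lt_le {N : ℕ} {x : Fin N → ℝ} (hmono : Monotone x) {n : Fin N} {t : ℝ}
    (h : t ≤ x n) : ({m | x m < t} : Set (Fin N)).ncard ≤ n := by
  have hsub : {m | x m < t} ⊆ (Finset.Iio n : Set (Fin N)) := fun m hm => by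
    simpa using hmono.reflect_lt (lt_of_lt_of_le hm h)
  have hcard := Set.ncard_le_ncard hsub (Set.toFinite _)
  rwa [Set.ncard_coe_finset, Fin.card_Iio] at hcard

theorem mul_grid {N : ℕ} (n : Fin N) : N * grid N n = n + 1 / 2 := by
  have : (N : ℝ) ≠ 0 := by exact_mod_cast n.pos.ne'
  rw [grid]
  field_simp

theorem grid_nonneg {N : ℕ} (n : Fin N) : 0 ≤ grid N n := by
  rw [grid]
  positivity

theorem grid_le_one {N : ℕ} (n : Fin N) : grid N n ≤ 1 := by
  have hN : (0 : ℝ) < N := by exact_mod_cast n.pos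
  have hn : (n : ℝ) + 1 ≤ N := by exact_mod_cast n.isLt
  nlinarith [mul_grid n]

theorem grid_monotone (N : ℕ) : Monotone (grid N) := fun m n h => by
  have hmn : (m : ℝ) ≤ n := by exact_mod_cast h
  unfold grid
  gcongr

theorem abs_disc_grid_le {N : ℕ} (hN : 1 ≤ N) {t : ℝ} (ht : t ∈ Set.Icc (0 : ℝ) 1) :
    |disc N (grid N) t| ≤ 1 / 2 := by
  have hN0 : (0 : ℝ) < N := by exact_mod_cast hN
  rw [disc_eq_ncard grid_nonneg]
  set k := ({n | grid N n < t} : Set (Fin N)).ncard with hk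
  have hkN : k ≤ N := by
    simpa using Set.ncard_le_card ({n | grid N n < t} : Set (Fin N))
  rw [abs_le]
  constructor
  · by_contra! hlt
    have hlt' : k < N := by
      have : (k : ℝ) < N := by nlinarith [ht.2]
      exact_mod_cast this
    have := mul_grid (⟨k, hlt'⟩ : Fin N)
    have := succ_le_ncard_lt (grid_monotone N) (n := ⟨k, hlt'⟩) (t := t)
      (lt_of_mul_lt_mul_left (by simp only at this; linarith) hN0.le)
    simp only at this
    omega
  · by_contra! hlt
    obtain ⟨j, hj⟩ : ∃ j, k = j + 1 := by
      refine Nat.exists_eq_succ_of_ne_zero fun h0 => ?_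
      rw [h0] at hlt
      push_cast at hlt
      nlinarith [ht.1]
    have hlt' : j < N := by omega
    have := mul_grid (⟨j, hlt'⟩ : Fin N)
    rw [hj] at hlt
    push_cast at hlt
    have := ncard_lt_le (grid_monotone N) (n := ⟨j, hlt'⟩) (t := t)
      (le_of_mul_le_mul_left (by simp only at this; linarith) hN0)
    simp only at this
    omega

theorem volume_sep_Icc_lt_one {p : ℝ → Prop} {a b : ℝ} (hab : a < b) (ha : 0 ≤ a) (hb : b ≤ 1)
    (h : ∀ t ∈ Set.Ioo a b, ¬ p t) :
    volume {t ∈ Set.Icc (0 : ℝ) 1 | p t} < 1 := by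
  have hdisj : Disjoint {t ∈ Set.Icc (0 : ℝ) 1 | p t} (Set.Ioo a b) :=
    Set.disjoint_left.2 fun t ht ht' => h t ht' ht.2
  have hsub : {t ∈ Set.Icc (0 : ℝ) 1 | p t} ∪ Set.Ioo a b ⊆ Set.Icc 0 1 :=
    Set.union_subset (Set.sep_subset _ _) fun t ht => ⟨ha.trans ht.1.le, ht.2.le.trans hb⟩
  have hle := measure_mono (μ := volume) hsub
  rw [measure_union hdisj measurableSet_Ioo, Real.volume_Icc, sub_zero, ENNReal.ofReal_one] at hle
  have hpos : volume (Set.Ioo a b) ≠ 0 := by simp [hab]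
  have hfin : volume {t ∈ Set.Icc (0 : ℝ) 1 | p t} ≠ ⊤ :=
    ne_top_of_le_ne_top ENNReal.one_ne_top (le_self_add.trans hle)
  exact (ENNReal.lt_add_right hfin hpos).trans_le hle

theorem equality_of_distributions_iff_grid (N : ℕ) (hN : 1 ≤ N)
    (x : Fin N → ℝ) (hx : ∀ n, x n ∈ Set.Icc (0:ℝ) 1) (hmono : Monotone x) :
    (∀ α : ℝ, 0 < α →
        volume {t ∈ Set.Icc (0:ℝ) 1 | |disc N x t| < α} =
          volume {t ∈ Set.Icc (0:ℝ) 1 | |disc N (grid N) t| < α}) ↔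
      x = grid N := by
  refine ⟨fun h => ?_, fun h => by simp [h]⟩
  have hN0 : (0 : ℝ) < N := by exact_mod_cast hN
  have hvol : ∀ α : ℝ, 1 / 2 < α → volume {t ∈ Set.Icc (0:ℝ) 1 | |disc N x t| < α} = 1 := by
    intro α hα
    have hall : {t ∈ Set.Icc (0:ℝ) 1 | |disc N (grid N) t| < α} = Set.Icc 0 1 :=
      Set.sep_eq_self_iff_mem_true.2 fun t ht => (abs_disc_grid_le hN ht).trans_lt hα
    rw [h α (by linarith), hall]
    simp
  have hdisc := disc_eq_ncard fun n => (hx n).1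
  funext n
  have hg := mul_grid n
  rcases lt_trichotomy (x n) (grid N n) with hlt | heq | hgt
  · have hpos := mul_pos hN0 (sub_pos.2 hlt)
    refine absurd (hvol (1 / 2 + N * (grid N n - x n) / 2) (by linarith)) (ne_of_lt ?_)
    refine volume_sep_Icc_lt_one (a := x n) (b := (x n + grid N n) / 2) (by linarith) (hx n).1
      (by linarith [grid_le_one n]) fun t ht => not_lt.2 (le_trans ?_ (le_abs_self _))
    have hc : (n : ℝ) + 1 ≤ ({m | x m < t} : Set (Fin N)).ncard := by
      exact_mod_cast succ_le_ncard_lt hmono ht.1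
    rw [hdisc]
    nlinarith [mul_lt_mul_of_pos_left ht.2 hN0]
  · exact heq
  · have hpos := mul_pos hN0 (sub_pos.2 hgt)
    refine absurd (hvol (1 / 2 + N * (x n - grid N n) / 2) (by linarith)) (ne_of_lt ?_)
    refine volume_sep_Icc_lt_one (a := (x n + grid N n) / 2) (b := x n) (by linarith)
      (by linarith [grid_nonneg n, (hx n).1]) (hx n).2
      fun t ht => not_lt.2 (le_trans ?_ (neg_le_abs _))
    have hc : (({m | x m < t} : Set (Fin N)).ncard : ℝ) ≤ n := by
      exact_mod_cast ncard_lt_le hmono ht.2.le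
    rw [hdisc]
    nlinarith [mul_lt_mul_of_pos_left ht.1 hN0]
end

section
/- Let f, g : ℝ → [0,∞] be symmetrically decreasing functions with 0 ≤ g ≤ 1 and ∫_ℝ g(t) dt = 1, and let M_1 = 1_{(−1/2,1/2)}. Suppose f is not constant almost everywhere, f ∗ g ∈ L¹(ℝ), and g is not equal to M_1 almost everywhere. Then there exists α > 0 such that ∫_{−α}^{α} (f ∗ g)(t) dt < ∫_{−α}^{α} (f ∗ M_1)(t) dt. -/
open MeasureTheory Set

/-- Convolution of `[0,∞]`-valued functions on `ℝ`. -/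
noncomputable def conv (f g : ℝ → ENNReal) (x : ℝ) : ENNReal := ∫⁻ y, f (x - y) * g y

/-- A function `f : ℝ → [0,∞]` is symmetrically decreasing if `f(-x) = f(x)` for all `x`
and `f(y) ≤ f(x)` whenever `0 < x < y`. -/
def SymmDecr (f : ℝ → ENNReal) : Prop :=
  (∀ x : ℝ, f (-x) = f x) ∧ ∀ x y : ℝ, 0 < x → x < y → f y ≤ f x

/-- `M₁ = 1_{(−1/2, 1/2)}` as a `[0,∞]`-valued function. -/
noncomputable def M1 : ℝ → ENNReal := (Set.Ioo (-(1:ℝ)/2) (1/2)).indicator (fun _ => 1)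

namespace SymmDecr

variable {f : ℝ → ENNReal}

lemma apply_abs (hf : SymmDecr f) (x : ℝ) : f |x| = f x := by
  rcases abs_choice x with h | h <;> rw [h]
  exact hf.1 x

lemma le_of_abs_le (hf : SymmDecr f) {x y : ℝ} (hx : x ≠ 0) (hxy : |x| ≤ |y|) : f y ≤ f x := by
  rw [← hf.apply_abs x, ← hf.apply_abs y]
  rcases hxy.eq_or_lt with h | h
  · rw [h]
  · exact hf.2 _ _ (abs_pos.2 hx) h

lemma measurable (hf : SymmDecr f) : Measurable f := by
  classical
  have hanti : Antitone fun x : ℝ => if 0 < x then f x else ⊤ := by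
    intro x y hxy
    by_cases hx : 0 < x
    · have hy : 0 < y := hx.trans_le hxy
      simp only [hx, hy, if_true]
      exact hf.le_of_abs_le hx.ne' (by rwa [abs_of_pos hx, abs_of_pos hy])
    · simp [hx]
  have heq : f = fun x => if x = 0 then f 0 else
      (fun x : ℝ => if 0 < x then f x else ⊤) |x| := by
    funext x
    by_cases hx : x = 0
    · simp [hx]
    · simp [hx, hf.apply_abs]
  rw [heq]
  exact Measurable.ite (measurableSet_singleton 0) measurable_const
    (hanti.measurable.comp measurable_norm)

lemma lt_top (hf : SymmDecr f) (hint : ∫⁻ x, f x < ⊤) {x : ℝ} (hx : x ≠ 0) : f x < ⊤ := by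
  by_contra hlt
  have hxtop : f x = ⊤ := not_lt_top_iff.1 hlt
  refine hint.not_ge ?_
  calc ⊤ = ∫⁻ _ in Ioo 0 |x|, (⊤ : ENNReal) := by simp [ENNReal.top_mul, hx]
    _ ≤ ∫⁻ y in Ioo 0 |x|, f y := by
      refine setLIntegral_mono hf.measurable fun y hy => ?_
      rw [← hxtop]
      exact hf.le_of_abs_le hy.1.ne' (by rw [abs_of_pos hy.1]; exact hy.2.le)
    _ ≤ ∫⁻ y, f y := setLIntegral_le_lintegral _ _

lemma exists_apply_add_one_lt (hf : SymmDecr f) (hint : ∫⁻ x, f x < ⊤)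
    (hne : ¬ f =ᵐ[volume] fun _ => 0) : ∃ s : ℝ, 0 < s ∧ f (s + 1) < f s := by
  obtain ⟨c, hc, hfc⟩ : ∃ c : ℝ, 0 < c ∧ f c ≠ 0 := by
    by_contra! h
    refine hne ?_
    filter_upwards [compl_mem_ae_iff.2 (measure_singleton (μ := volume) (0 : ℝ))] with x hx
    rw [← hf.apply_abs]
    exact h _ (abs_pos.2 hx)
  by_contra! h
  have hstep : ∀ n : ℕ, f c ≤ f (c + n) := by
    intro n
    induction n with
    | zero => simp
    | succ n ih =>
      refine ih.trans ((h (c + n) (by positivity)).trans_eq ?_)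
      push_cast
      rw [add_assoc]
  refine hint.not_ge ?_
  calc ⊤ = ∫⁻ _ in Ioi c, f c := by simp [ENNReal.mul_top, hfc]
    _ ≤ ∫⁻ y in Ioi c, f y := by
      refine setLIntegral_mono hf.measurable fun y hy => ?_
      obtain ⟨n, hn⟩ := exists_nat_gt y
      have hy' : 0 < y := hc.trans hy
      refine (hstep n).trans (hf.le_of_abs_le hy'.ne' ?_)
      rw [abs_of_pos hy', abs_of_pos (by positivity)]
      linarith
    _ ≤ ∫⁻ y, f y := setLIntegral_le_lintegral _ _

lemma integrable_toReal (hf : SymmDecr f) (hint : ∫⁻ x, f x < ⊤) :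
    Integrable fun x => (f x).toReal :=
  integrable_toReal_of_lintegral_ne_top hf.measurable.aemeasurable hint.ne

lemma setLIntegral_translate (hf : SymmDecr f) (hint : ∫⁻ x, f x < ⊤) {α : ℝ} (hα : 0 < α)
    (y : ℝ) : ∫⁻ t in Ioo (-α) α, f (t - y) =
      ENNReal.ofReal (∫ t in (-α - y)..(α - y), (f t).toReal) := by
  rw [← intervalIntegral.integral_comp_sub_right (fun t => (f t).toReal),
    intervalIntegral.integral_of_le (by linarith), integral_Ioc_eq_integral_Ioo,
    ofReal_integral_eq_lintegral_ofReal
      (((hf.integrable_toReal hint).comp_sub_right y).integrableOn)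
      (Filter.Eventually.of_forall fun _ => ENNReal.toReal_nonneg)]
  refine lintegral_congr_ae (ae_restrict_of_ae ?_)
  filter_upwards [compl_mem_ae_iff.2 (measure_singleton (μ := volume) y)] with t ht
  exact (ENNReal.ofReal_toReal (hf.lt_top hint (sub_ne_zero.2 ht)).ne).symm

lemma setLIntegral_translate_neg (hf : SymmDecr f) (α y : ℝ) :
    ∫⁻ t in Ioo (-α) α, f (t - -y) = ∫⁻ t in Ioo (-α) α, f (t - y) := by
  rw [← lintegral_indicator measurableSet_Ioo, ← lintegral_indicator measurableSet_Ioo,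
    ← lintegral_neg_eq_self]
  refine lintegral_congr fun t => ?_
  have hmem : -t ∈ Ioo (-α) α ↔ t ∈ Ioo (-α) α := by
    simp only [mem_Ioo, neg_lt_neg_iff]
    constructor <;> rintro ⟨h₁, h₂⟩ <;> constructor <;> linarith
  by_cases ht : t ∈ Ioo (-α) α
  · rw [indicator_of_mem (hmem.2 ht), indicator_of_mem ht, ← hf.1]
    congr 1
    ring
  · rw [indicator_of_notMem (mt hmem.1 ht), indicator_of_notMem ht]

lemma setLIntegral_translate_abs (hf : SymmDecr f) (α y : ℝ) :
    ∫⁻ t in Ioo (-α) α, f (t - |y|) = ∫⁻ t in Ioo (-α) α, f (t - y) := by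
  rcases abs_choice y with h | h <;> rw [h]
  exact hf.setLIntegral_translate_neg α y

lemma integral_window_sub (hf : SymmDecr f) (hint : ∫⁻ x, f x < ⊤) (α y z : ℝ) :
    (∫ t in (-α - y)..(α - y), (f t).toReal) - ∫ t in (-α - z)..(α - z), (f t).toReal =
      ∫ s in y..z, ((f (α - s)).toReal - (f (α + s)).toReal) := by
  have hi := hf.integrable_toReal hint
  have hii : ∀ a b : ℝ, IntervalIntegrable (fun x => (f x).toReal) volume a b :=
    fun a b => hi.intervalIntegrable
  have heven : ∀ s, (f (α + s)).toReal = (f (-α - s)).toReal := by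
    intro s
    rw [← hf.1 (α + s), neg_add']
  simp only [heven]
  rw [intervalIntegral.integral_sub (hi.comp_sub_left α).intervalIntegrable
      (hi.comp_sub_left (-α)).intervalIntegrable,
    intervalIntegral.integral_comp_sub_left (fun t => (f t).toReal),
    intervalIntegral.integral_comp_sub_left (fun t => (f t).toReal)]
  have h₁ := intervalIntegral.integral_add_adjacent_intervals
    (hii (-α - z) (-α - y)) (hii (-α - y) (α - y))
  have h₂ := intervalIntegral.integral_add_adjacent_intervals
    (hii (-α - z) (α - z)) (hii (α - z) (α - y))
  linarith

lemma setLIntegral_translate_anti (hf : SymmDecr f) (hint : ∫⁻ x, f x < ⊤) {α : ℝ} (hα : 0 < α)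
    {y z : ℝ} (hyz : |y| ≤ |z|) :
    ∫⁻ t in Ioo (-α) α, f (t - z) ≤ ∫⁻ t in Ioo (-α) α, f (t - y) := by
  rw [← hf.setLIntegral_translate_abs α z, ← hf.setLIntegral_translate_abs α y,
    hf.setLIntegral_translate hint hα, hf.setLIntegral_translate hint hα]
  refine ENNReal.ofReal_le_ofReal (sub_nonneg.1 ?_)
  rw [hf.integral_window_sub hint, intervalIntegral.integral_of_le hyz]
  refine setIntegral_nonneg_of_ae_restrict ?_
  filter_upwards [ae_restrict_mem measurableSet_Ioc,
    ae_restrict_of_ae (compl_mem_ae_iff.2 (measure_singleton (μ := volume) α))] with s hs hsα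
  have hs0 : 0 < s := (abs_nonneg y).trans_lt hs.1
  have hne : α - s ≠ 0 := sub_ne_zero.2 (Ne.symm hsα)
  refine sub_nonneg.2 (ENNReal.toReal_mono (hf.lt_top hint hne).ne (hf.le_of_abs_le hne ?_))
  rw [abs_of_pos (by linarith : 0 < α + s), abs_le]
  constructor <;> linarith

lemma setLIntegral_translate_strictAnti (hf : SymmDecr f) (hint : ∫⁻ x, f x < ⊤) {s y z : ℝ}
    (hs : 0 < s) (hlt : f (s + 2 * y) < f s) (hy : 0 < y) (hyz : y < |z|) :
    ∫⁻ t in Ioo (-(s + y)) (s + y), f (t - z) < ∫⁻ t in Ioo (-(s + y)) (s + y), f (t - y) := by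
  have hα : 0 < s + y := by positivity
  have hyw : y < min |z| (s + y) := lt_min hyz (by linarith)
  refine (hf.setLIntegral_translate_anti hint hα (y := min |z| (s + y)) ?_).trans_lt ?_
  · rw [abs_of_pos (hy.trans hyw)]
    exact min_le_left _ _
  have hpos : 0 < ∫ r in y..(min |z| (s + y)),
      ((f (s + y - r)).toReal - (f (s + y + r)).toReal) := by
    have hi := hf.integrable_toReal hint
    refine intervalIntegral.intervalIntegral_pos_of_pos_on
      ((hi.comp_sub_left _).sub (hi.comp_add_left _)).intervalIntegrable (fun r hr => ?_) hyw
    have hr' : r < s + y := hr.2.trans_le (min_le_right _ _)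
    have hne : s + y - r ≠ 0 := by linarith
    refine sub_pos.2 (ENNReal.toReal_strict_mono (hf.lt_top hint hne).ne ?_)
    calc f (s + y + r) ≤ f (s + 2 * y) := hf.2 _ _ (by positivity) (by linarith [hr.1])
      _ < f s := hlt
      _ ≤ f (s + y - r) := hf.2 _ _ (by linarith) (by linarith [hr.1])
  rw [← hf.integral_window_sub hint] at hpos
  rw [hf.setLIntegral_translate hint hα, hf.setLIntegral_translate hint hα]
  have hw : 0 ≤ ∫ t in (-(s + y) - min |z| (s + y))..(s + y - min |z| (s + y)), (f t).toReal :=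
    intervalIntegral.integral_nonneg (by linarith) fun _ _ => ENNReal.toReal_nonneg
  exact (ENNReal.ofReal_lt_ofReal_iff (by linarith)).2 (by linarith)

end SymmDecr

lemma lintegral_conv {f g : ℝ → ENNReal} (hf : Measurable f) (hg : Measurable g) (s : Set ℝ) :
    ∫⁻ t in s, conv f g t = ∫⁻ y, (∫⁻ t in s, f (t - y)) * g y := by
  unfold conv
  rw [lintegral_lintegral_swap]
  · exact lintegral_congr fun y => lintegral_mul_const _ (hf.comp (measurable_id.sub_const y))
  · exact ((hf.comp (measurable_fst.sub measurable_snd)).mul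
      (hg.comp measurable_snd)).aemeasurable

lemma measurable_M1 : Measurable M1 := measurable_const.indicator measurableSet_Ioo

lemma lintegral_M1 : ∫⁻ x, M1 x = 1 := by
  unfold M1
  rw [lintegral_indicator measurableSet_Ioo]
  norm_num

lemma M1_of_abs_lt {x : ℝ} (hx : |x| < 1 / 2) : M1 x = 1 :=
  indicator_of_mem (by rw [abs_lt] at hx; constructor <;> linarith [hx.1, hx.2]) _

lemma M1_of_le_abs {x : ℝ} (hx : 1 / 2 ≤ |x|) : M1 x = 0 := by
  refine indicator_of_notMem (fun h => hx.not_gt (abs_lt.2 ⟨?_, h.2⟩)) _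
  linarith [h.1]

lemma ENNReal.mul_add_le_add_mul {a k b : ENNReal} (hk : k ≤ a) (hb : b ≤ 1) :
    a * b + k ≤ a + k * b := by
  obtain ⟨d, rfl⟩ := exists_add_of_le hk
  rw [add_mul]
  calc k * b + d * b + k ≤ k * b + d * 1 + k := by gcongr
    _ = k + d + k * b := by ring

/-- Strict form of the bathtub principle for a weight `F` that is at least `k` on
`(-1/2, 1/2)` and less than `k` outside `[-1/2, 1/2]`. -/
lemma lintegral_mul_lt_lintegral_mul_M1 {F g : ℝ → ENNReal} (hF : Measurable F)
    (hg : Measurable g) (hg1 : ∀ x, g x ≤ 1) (hgint : ∫⁻ x, g x = 1)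
    (hgne : ¬ g =ᵐ[volume] M1) (hfin : ∫⁻ x, F x * g x ≠ ⊤) {k : ENNReal} (hk : k ≠ ⊤)
    (hin : ∀ x, |x| < 1 / 2 → k ≤ F x) (hout : ∀ x, 1 / 2 < |x| → F x < k) :
    ∫⁻ x, F x * g x < ∫⁻ x, F x * M1 x := by
  have hhalf : ∀ᵐ x : ℝ, |x| ≠ 1 / 2 := by
    filter_upwards [compl_mem_ae_iff.2 (measure_singleton (μ := volume) (1 / 2 : ℝ)),
      compl_mem_ae_iff.2 (measure_singleton (μ := volume) (-(1 / 2) : ℝ))] with x h₁ h₂ h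
    rcases eq_or_eq_neg_of_abs_eq h with h | h
    exacts [h₁ h, h₂ h]
  have hsum₁ : ∫⁻ x, (F x * g x + k * M1 x) = (∫⁻ x, F x * g x) + k := by
    rw [lintegral_add_right _ (measurable_M1.const_mul k),
      lintegral_const_mul _ measurable_M1, lintegral_M1, mul_one]
  have hsum₂ : ∫⁻ x, (F x * M1 x + k * g x) = (∫⁻ x, F x * M1 x) + k := by
    rw [lintegral_add_right _ (hg.const_mul k), lintegral_const_mul _ hg, hgint, mul_one]
  have hle : ∀ᵐ x, F x * g x + k * M1 x ≤ F x * M1 x + k * g x := by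
    filter_upwards [hhalf] with x hx
    rcases hx.lt_or_gt with h | h
    · simpa [M1_of_abs_lt h] using ENNReal.mul_add_le_add_mul (hin x h) (hg1 x)
    · simpa [M1_of_le_abs h.le] using mul_le_mul_left (hout x h).le (g x)
  have hlt : ∫⁻ x, (F x * g x + k * M1 x) < ∫⁻ x, (F x * M1 x + k * g x) := by
    refine lintegral_strict_mono_of_ae_le_of_frequently_ae_lt
      ((hF.mul measurable_M1).add (hg.const_mul k)).aemeasurable ?_ hle ?_
    · rw [hsum₁]
      exact ENNReal.add_ne_top.2 ⟨hfin, hk⟩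
    · intro heq
      refine hgne (ae_eq_of_ae_le_of_lintegral_le ?_ (by simp [hgint])
        measurable_M1.aemeasurable (by rw [hgint, lintegral_M1]))
      filter_upwards [hhalf, heq] with x hx hx'
      rcases hx.lt_or_gt with h | h
      · rw [M1_of_abs_lt h]
        exact hg1 x
      · have hx'' : F x * g x = k * g x := by
          simpa [M1_of_le_abs h.le] using hx'
        by_contra hgx
        have hg0 : g x ≠ 0 := fun h0 => hgx (by simp [h0])
        exact (ENNReal.mul_lt_mul_left hg0 ((hg1 x).trans_lt ENNReal.one_lt_top).ne
          (hout x h)).ne hx''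
  rw [hsum₁, hsum₂] at hlt
  exact lt_of_add_lt_add_right hlt

theorem conv_strict_inequality (f g : ℝ → ENNReal)
    (hf : SymmDecr f) (hg : SymmDecr g)
    (hg1 : ∀ x, g x ≤ 1) (hgint : ∫⁻ x, g x = 1)
    (hfnotconst : ¬ ∃ c : ENNReal, f =ᵐ[volume] fun _ => c)
    (hL1 : ∫⁻ x, conv f g x < ⊤)
    (hgneM1 : ¬ g =ᵐ[volume] M1) :
    ∃ α : ℝ, 0 < α ∧
      ∫⁻ t in Set.Ioo (-α) α, conv f g t < ∫⁻ t in Set.Ioo (-α) α, conv f M1 t := by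
  have hint : ∫⁻ x, f x < ⊤ := by
    rw [← setLIntegral_univ, lintegral_conv hf.measurable hg.measurable] at hL1
    simp only [setLIntegral_univ, lintegral_sub_right_eq_self f] at hL1
    rwa [lintegral_const_mul _ hg.measurable, hgint, mul_one] at hL1
  obtain ⟨s, hs, hlt⟩ := hf.exists_apply_add_one_lt hint fun h => hfnotconst ⟨0, h⟩
  have hα : 0 < s + 1 / 2 := by positivity
  refine ⟨s + 1 / 2, hα, ?_⟩
  have hfin : ∫⁻ t in Ioo (-(s + 1 / 2)) (s + 1 / 2), conv f g t ≠ ⊤ :=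
    ((setLIntegral_le_lintegral _ _).trans_lt hL1).ne
  rw [lintegral_conv hf.measurable hg.measurable] at hfin ⊢
  rw [lintegral_conv hf.measurable measurable_M1]
  refine lintegral_mul_lt_lintegral_mul_M1 ?_ hg.measurable hg1 hgint hgneM1 hfin
    (k := ∫⁻ t in Ioo (-(s + 1 / 2)) (s + 1 / 2), f (t - 1 / 2)) ?_
    (fun y hy => ?_) (fun y hy => ?_)
  · exact (hf.measurable.comp (measurable_snd.sub measurable_fst)).lintegral_prod_right'
  · rw [hf.setLIntegral_translate hint hα]
    exact ENNReal.ofReal_ne_top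
  · exact hf.setLIntegral_translate_anti hint hα
      (by rw [abs_of_pos (one_half_pos (α := ℝ))]; exact hy.le)
  · exact hf.setLIntegral_translate_strictAnti hint hs (by norm_num; exact hlt) one_half_pos hy
end

section
/- For every natural number N ≥ 1 and every α ≥ 0, the two-dimensional Lebesgue measure of {(t_1,t_2) ∈ [0,1]² : |D̃_{Γ_N}(t_1,t_2)| ≥ α} equals (1 − min(α,1))², where Γ_N is the centered regular grid. -/
open MeasureTheory Set

/-- Two-parameter discrepancy function on `[0,1]²`. -/
noncomputable def disc2 (N : ℕ) (x : Fin N → ℝ) (t₁ t₂ : ℝ) : ℝ :=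
  disc N x t₂ - disc N x t₁

/-- The map `t ↦ fract (c + n t)` has the same law on the unit interval as the identity. -/
theorem measurePreserving_fract_add_intCast_mul {n : ℤ} (hn : n ≠ 0) (c : ℝ) :
    MeasurePreserving (fun t : ℝ => Int.fract (c + n * t))
      (volume.restrict (Ioc (0:ℝ) 1)) (volume.restrict (Ioc (0:ℝ) 1)) := by
  have hmk : MeasurePreserving (fun t : ℝ => (t : AddCircle (1:ℝ)))
      (volume.restrict (Ioc (0:ℝ) 1)) volume := by
    simpa using AddCircle.measurePreserving_mk (1:ℝ) 0
  let h : AddCircle (1:ℝ) → ℝ := fun z => (AddCircle.measurableEquivIco (1:ℝ) 0 z : ℝ)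
  have hh : Measurable h :=
    measurable_subtype_coe.comp (AddCircle.measurableEquivIco (1:ℝ) 0).measurable
  have hfract : ∀ t : ℝ, h (t : AddCircle (1:ℝ)) = Int.fract t := fun t => by
    have := AddCircle.coe_equivIco_mk_apply (p := (1:ℝ)) t
    rw [div_one, mul_one] at this
    exact this
  have hlaw : Measure.map h volume = volume.restrict (Ioc (0:ℝ) 1) := by
    rw [← hmk.map_eq, Measure.map_map hh hmk.measurable, restrict_Ioo_eq_restrict_Ioc.symm]
    conv_rhs => rw [← Measure.map_id (μ := volume.restrict (Ioo (0:ℝ) 1))]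
    refine Measure.map_congr ?_
    filter_upwards [ae_restrict_mem measurableSet_Ioo] with t ht
    simp only [Function.comp_apply, hfract, id]
    exact Int.fract_eq_self.2 ⟨ht.1.le, ht.2⟩
  have hcomp := (MeasurePreserving.mk hh hlaw).comp
    ((measurePreserving_add_left volume (c : AddCircle (1:ℝ))).comp
      ((Measure.measurePreserving_zsmul (volume : Measure (AddCircle (1:ℝ))) hn).comp hmk))
  refine (funext fun t => ?_ : _ = fun t : ℝ => Int.fract (c + n * t)) ▸ hcomp
  simp only [Function.comp_apply]
  rw [← AddCircle.coe_zsmul, ← AddCircle.coe_add, hfract, zsmul_eq_mul]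

theorem card_grid_mem_Ico {N : ℕ} (hN : 1 ≤ N) {t : ℝ} (ht : t ∈ Icc (0:ℝ) 1) :
    ∑ n : Fin N, (Ico (0:ℝ) t).indicator (fun _ => (1:ℝ)) (grid N n) =
      (⌈(N:ℝ) * t - 1 / 2⌉ : ℝ) := by
  have hN' : (0:ℝ) < N := by exact_mod_cast hN
  have hle : ⌈(N:ℝ) * t - 1 / 2⌉₊ ≤ N := by
    rw [Nat.ceil_le]
    nlinarith [ht.2]
  have hmem : ∀ n : Fin N, grid N n ∈ Ico (0:ℝ) t ↔ (n : ℕ) < ⌈(N:ℝ) * t - 1 / 2⌉₊ := fun n => by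
    have h0 : 0 ≤ grid N n := by unfold grid; positivity
    rw [Nat.lt_ceil, mem_Ico, and_iff_right h0, grid, div_lt_iff₀ (by positivity)]
    constructor <;> intro h <;> linarith
  simp only [indicator_apply, hmem]
  rw [Finset.sum_boole, Fin.card_filter_val_lt, min_eq_right hle]
  refine natCast_ceil_eq_intCast_ceil_of_neg_one_lt ?_
  nlinarith [mul_nonneg hN'.le ht.1]

theorem disc_grid {N : ℕ} (hN : 1 ≤ N) {t : ℝ} (ht : t ∈ Icc (0:ℝ) 1) :
    disc N (grid N) t = Int.fract (1 / 2 + ((-N : ℤ) : ℝ) * t) - 1 / 2 := by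
  have h : 1 / 2 + ((-N : ℤ) : ℝ) * t = -((N:ℝ) * t - 1 / 2) := by push_cast; ring
  rw [disc, card_grid_mem_Ico hN ht, h, Int.fract, Int.floor_neg]
  push_cast
  ring

theorem integral_max_sub_zero {α : ℝ} (h0 : 0 ≤ α) (h1 : α ≤ 1) :
    ∫ x in (0:ℝ)..1, max (x - α) 0 = (1 - α) ^ 2 / 2 := by
  have hc : Continuous fun x : ℝ => max (x - α) 0 := by fun_prop
  rw [← intervalIntegral.integral_add_adjacent_intervals (hc.intervalIntegrable 0 α)
    (hc.intervalIntegrable α 1)]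
  have e1 : ∫ x in (0:ℝ)..α, max (x - α) 0 = 0 := by
    rw [intervalIntegral.integral_congr (g := fun _ => (0:ℝ))]
    · simp
    · intro x hx
      rw [uIcc_of_le h0] at hx
      exact max_eq_right (by linarith [hx.2])
  have e2 : ∫ x in α..1, max (x - α) 0 = ∫ x in α..1, (x - α) := by
    refine intervalIntegral.integral_congr fun x hx => ?_
    rw [uIcc_of_le h1] at hx
    exact max_eq_left (by linarith [hx.1])
  rw [e1, e2, intervalIntegral.integral_comp_sub_right (fun x => x) α]
  simp

theorem lintegral_ofReal_max {f : ℝ → ℝ} (hf : Continuous f) :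
    ∫⁻ x in Ioc (0:ℝ) 1, ENNReal.ofReal (f x) =
      ENNReal.ofReal (∫ x in (0:ℝ)..1, max (f x) 0) := by
  have hc : Continuous fun x : ℝ => max (f x) 0 := by fun_prop
  rw [intervalIntegral.integral_of_le zero_le_one, ofReal_integral_eq_lintegral_ofReal
    (hc.integrableOn_Ioc) (.of_forall fun x => le_max_right _ _)]
  refine lintegral_congr fun x => ?_
  rw [ENNReal.ofReal_max, ENNReal.ofReal_zero, max_eq_left (zero_le)]

/-- Probability that two independent uniform variables on `[0,1]` differ by at least `α`. -/
theorem prod_restrict_Ioc_le_abs_sub {α : ℝ} (h0 : 0 < α) (h1 : α ≤ 1) :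
    ((volume.restrict (Ioc (0:ℝ) 1)).prod (volume.restrict (Ioc (0:ℝ) 1)))
      {p : ℝ × ℝ | α ≤ |p.2 - p.1|} = ENNReal.ofReal ((1 - α) ^ 2) := by
  have hm : MeasurableSet {p : ℝ × ℝ | α ≤ |p.2 - p.1|} :=
    measurableSet_le measurable_const (by fun_prop)
  have hslice : ∀ x ∈ Ioc (0:ℝ) 1, volume.restrict (Ioc (0:ℝ) 1)
      (Prod.mk x ⁻¹' {p : ℝ × ℝ | α ≤ |p.2 - p.1|}) =
      ENNReal.ofReal (x - α) + ENNReal.ofReal (1 - x - α) := fun x hx => by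
    rw [Measure.restrict_apply (measurable_prodMk_left hm)]
    have : Prod.mk x ⁻¹' {p : ℝ × ℝ | α ≤ |p.2 - p.1|} ∩ Ioc (0:ℝ) 1 =
        Ioc 0 (x - α) ∪ Icc (x + α) 1 := by
      ext y
      simp only [mem_inter_iff, mem_preimage, mem_ofPred_eq, mem_union, mem_Ioc, mem_Icc, le_abs]
      have := hx.1
      have := hx.2
      grind
    rw [this, measure_union _ measurableSet_Icc, Real.volume_Ioc, Real.volume_Icc]
    · ring_nf
    · rw [Set.disjoint_left]
      intro y hy hy'
      linarith [hy.2, hy'.1]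
  rw [Measure.prod_apply hm, setLIntegral_congr_fun measurableSet_Ioc hslice,
    lintegral_add_left (by fun_prop), lintegral_ofReal_max (by fun_prop),
    lintegral_ofReal_max (by fun_prop),
    intervalIntegral.integral_comp_sub_left (fun x => max (x - α) 0) 1, sub_self, sub_zero,
    integral_max_sub_zero h0.le h1, ← ENNReal.ofReal_add (by positivity) (by positivity),
    add_halves]

theorem distribution_of_grid_two_param (N : ℕ) (hN : 1 ≤ N) (α : ℝ) (hα : 0 ≤ α) :
    volume {p : ℝ × ℝ | p.1 ∈ Set.Icc (0:ℝ) 1 ∧ p.2 ∈ Set.Icc (0:ℝ) 1 ∧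
        α ≤ |disc2 N (grid N) p.1 p.2|} =
      ENNReal.ofReal ((1 - min α 1) ^ 2) := by
  let g : ℝ → ℝ := fun t => Int.fract (1 / 2 + ((-N : ℤ) : ℝ) * t)
  have hg := measurePreserving_fract_add_intCast_mul (n := -N) (by omega) (1 / 2)
  have hset : {p : ℝ × ℝ | p.1 ∈ Set.Icc (0:ℝ) 1 ∧ p.2 ∈ Set.Icc (0:ℝ) 1 ∧
      α ≤ |disc2 N (grid N) p.1 p.2|} =
      Prod.map g g ⁻¹' {p : ℝ × ℝ | α ≤ |p.2 - p.1|} ∩ Icc (0:ℝ) 1 ×ˢ Icc (0:ℝ) 1 := by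
    ext p
    simp only [mem_ofPred_eq, mem_inter_iff, mem_preimage, mem_prod, Prod.map_fst, Prod.map_snd]
    rw [and_comm (b := p.1 ∈ _ ∧ _), and_assoc]
    refine and_congr_right fun h1 => and_congr_right fun h2 => ?_
    rw [disc2, disc_grid hN h1, disc_grid hN h2, sub_sub_sub_cancel_right]
  have hm : MeasurableSet {p : ℝ × ℝ | α ≤ |p.2 - p.1|} :=
    measurableSet_le measurable_const (by fun_prop)
  rcases hα.eq_or_lt with rfl | hpos
  · rw [hset]
    simp only [abs_nonneg, ofPred_true, preimage_univ, univ_inter]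
    rw [Measure.volume_eq_prod, Measure.prod_prod]
    simp
  rcases le_or_gt α 1 with h1 | h1
  · rw [hset, ← Measure.restrict_apply (hg.measurable.prodMap hg.measurable hm),
      Measure.volume_eq_prod, ← Measure.prod_restrict, ← restrict_Ioc_eq_restrict_Icc,
      (hg.prod hg).measure_preimage hm.nullMeasurableSet,
      prod_restrict_Ioc_le_abs_sub hpos h1, min_eq_left h1]
  · have hempty : Prod.map g g ⁻¹' {p : ℝ × ℝ | α ≤ |p.2 - p.1|} = ∅ := by
      rw [eq_empty_iff_forall_notMem]
      intro p hp
      have : |g p.2 - g p.1| < 1 := Int.abs_sub_lt_one_of_floor_eq_floor (by simp [g])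
      exact absurd (h1.trans_le hp) this.not_gt
    rw [hset, hempty, empty_inter, measure_empty, min_eq_right h1.le]
    simp
end

section
/- For every natural number N ≥ 1 and every p ∈ (0,∞): the infimum over all N-element point sets P in [0,1] of ∫_0^1 |D_P(t)|^p dt equals 1/(2^p (p+1)), and the infimum over all N-element point sets P of ∫_0^1 ∫_0^1 |D̃_P(t_1,t_2)|^p dt_2 dt_1 equals 2/((p+1)(p+2)). -/
open MeasureTheory Set

open ProbabilityTheory

/-- Precomposing with `t ↦ fract (c - N t)` does not change the integral over `[0,1]`. -/
lemma integral_comp_fract_sub_nat_mul {N : ℕ} (hN : 1 ≤ N) (c : ℝ) {h : ℝ → ℝ}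
    (hint : IntervalIntegrable h volume 0 1) :
    ∫ t in (0:ℝ)..1, h (Int.fract (c - N * t)) = ∫ t in (0:ℝ)..1, h t := by
  have hper : Function.Periodic (fun s : ℝ => h (Int.fract s)) 1 := fun s => by
    simp only [Int.fract_add_one]
  have heq : EqOn (fun s : ℝ => h (Int.fract s)) h (uIoo 0 1) := fun s hs => by
    rw [uIoo_of_le zero_le_one] at hs
    simp only [Int.fract_eq_self.2 ⟨hs.1.le, hs.2⟩]
  have hint' : IntervalIntegrable (fun s : ℝ => h (Int.fract s)) volume 0 1 :=
    hint.congr_uIoo heq.symm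
  have hN0 : (N : ℝ) ≠ 0 := by positivity
  have hbase := hper.intervalIntegral_add_zsmul_eq (N : ℤ) (c - N)
    (hper.intervalIntegrable₀ one_ne_zero hint')
  rw [hper.intervalIntegral_add_eq (c - N) 0, zero_add,
    intervalIntegral.integral_congr_uIoo heq] at hbase
  rw [intervalIntegral.integral_comp_sub_mul (fun s => h (Int.fract s)) hN0 c]
  have h1 : c - (N : ℝ) * 1 = c - N := by ring
  have h2 : c - (N : ℝ) * 0 = c - N + (N : ℤ) • (1 : ℝ) := by simp
  rw [h1, h2, hbase]
  simp [hN0]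

lemma integral_abs_sub_rpow {p : ℝ} (hp : 0 < p) {a : ℝ} (ha : a ∈ Icc (0:ℝ) 1) :
    ∫ v in (0:ℝ)..1, |v - a| ^ p = (a ^ (p + 1) + (1 - a) ^ (p + 1)) / (p + 1) := by
  have hc : Continuous fun v : ℝ => |v - a| ^ p := by fun_prop (disch := positivity)
  rw [← intervalIntegral.integral_add_adjacent_intervals (hc.intervalIntegrable 0 a)
    (hc.intervalIntegrable a 1)]
  have hleft : ∫ v in (0:ℝ)..a, |v - a| ^ p = a ^ (p + 1) / (p + 1) := by
    have : ∫ v in (0:ℝ)..a, |v - a| ^ p = ∫ v in (0:ℝ)..a, (a - v) ^ p := by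
      refine intervalIntegral.integral_congr fun v hv => ?_
      rw [uIcc_of_le ha.1] at hv
      simp only [abs_sub_comm v a, abs_of_nonneg (sub_nonneg.2 hv.2)]
    rw [this, intervalIntegral.integral_comp_sub_left (fun v => v ^ p) a,
      integral_rpow (Or.inl (by linarith))]
    simp [Real.zero_rpow (by linarith : p + 1 ≠ 0)]
  have hright : ∫ v in a..1, |v - a| ^ p = (1 - a) ^ (p + 1) / (p + 1) := by
    have : ∫ v in a..1, |v - a| ^ p = ∫ v in a..1, (v - a) ^ p := by
      refine intervalIntegral.integral_congr fun v hv => ?_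
      rw [uIcc_of_le ha.2] at hv
      simp only [abs_of_nonneg (sub_nonneg.2 hv.1)]
    rw [this, intervalIntegral.integral_comp_sub_right (fun v => v ^ p) a,
      integral_rpow (Or.inl (by linarith))]
    simp [Real.zero_rpow (by linarith : p + 1 ≠ 0)]
  rw [hleft, hright, add_div]

lemma integral_abs_sub_half_rpow {p : ℝ} (hp : 0 < p) :
    ∫ v in (0:ℝ)..1, |v - 1 / 2| ^ p = 1 / (2 ^ p * (p + 1)) := by
  rw [integral_abs_sub_rpow hp (by norm_num)]
  rw [show (1:ℝ) - 1 / 2 = 1 / 2 by norm_num, Real.rpow_add (by norm_num), Real.rpow_one,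
    Real.div_rpow zero_le_one zero_le_two, Real.one_rpow]
  field_simp
  norm_num

lemma integral_integral_abs_sub_rpow {p : ℝ} (hp : 0 < p) :
    ∫ u in (0:ℝ)..1, ∫ v in (0:ℝ)..1, |v - u| ^ p = 2 / ((p + 1) * (p + 2)) := by
  have hinner : ∫ u in (0:ℝ)..1, ∫ v in (0:ℝ)..1, |v - u| ^ p =
      ∫ u in (0:ℝ)..1, (u ^ (p + 1) + (1 - u) ^ (p + 1)) / (p + 1) := by
    refine intervalIntegral.integral_congr fun u hu => ?_
    rw [uIcc_of_le zero_le_one] at hu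
    exact integral_abs_sub_rpow hp hu
  have hp1 : 0 ≤ p + 1 := by linarith
  have hc : Continuous fun u : ℝ => u ^ (p + 1) := Real.continuous_rpow_const hp1
  have hc' : Continuous fun u : ℝ => (1 - u) ^ (p + 1) := hc.comp (by fun_prop)
  rw [hinner, intervalIntegral.integral_div,
    intervalIntegral.integral_add (hc.intervalIntegrable _ _) (hc'.intervalIntegrable _ _),
    intervalIntegral.integral_comp_sub_left (fun v => v ^ (p + 1)) 1, sub_zero, sub_self,
    integral_rpow (Or.inl (by linarith)), Real.one_rpow,
    Real.zero_rpow (by linarith : p + 1 + 1 ≠ 0)]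
  field_simp
  ring

/-- Probability integral transform: a real random variable with continuous distribution function
`F` is mapped by `F` to a uniformly distributed one. -/
lemma map_cdf_eq_volume_restrict (ν : Measure ℝ) [IsProbabilityMeasure ν]
    (hF : Continuous (cdf ν)) :
    ν.map (cdf ν) = volume.restrict (Ioc (0:ℝ) 1) := by
  have : IsProbabilityMeasure (ν.map (cdf ν)) := Measure.isProbabilityMeasure_map hF.aemeasurable
  have hmono := monotone_cdf ν
  have hmeas : ∀ u, MeasurableSet {x | cdf ν x ≤ u} := fun u =>
    measurableSet_le hF.measurable measurable_const
  have hivt : ∀ u ∈ Ioo (0:ℝ) 1, ∃ y, cdf ν y = u := fun u hu => by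
    obtain ⟨a, ha⟩ := ((tendsto_cdf_atBot ν).eventually (gt_mem_nhds hu.1)).exists
    obtain ⟨b, hb⟩ := ((tendsto_cdf_atTop ν).eventually (lt_mem_nhds hu.2)).exists
    exact mem_range_of_exists_le_of_exists_ge hF ⟨a, ha.le⟩ ⟨b, hb.le⟩
  have hlower : ∀ u ∈ Ioo (0:ℝ) 1, u ≤ ν.real {x | cdf ν x ≤ u} := fun u hu => by
    obtain ⟨y, rfl⟩ := hivt u hu
    rw [cdf_eq_real]
    exact measureReal_mono fun x hx => by
      rw [mem_ofPred_eq, ← cdf_eq_real]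
      exact hmono hx
  have hupper : ∀ u, 0 ≤ u → u < 1 → ν.real {x | cdf ν x ≤ u} ≤ u := fun u hu0 hu1 => by
    refine le_of_forall_gt_imp_ge_of_dense fun w hw => ?_
    rcases lt_or_ge w 1 with hw1 | hw1
    · obtain ⟨y, rfl⟩ := hivt w ⟨hu0.trans_lt hw, hw1⟩
      rw [cdf_eq_real ν y]
      refine measureReal_mono fun x hx => ?_
      exact (hmono.reflect_lt (lt_of_le_of_lt hx hw)).le
    · exact measureReal_le_one.trans hw1
  refine Measure.ext_of_Iic _ _ fun u => ?_
  rw [Measure.map_apply hF.measurable measurableSet_Iic,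
    Measure.restrict_apply measurableSet_Iic]
  change ν {x | cdf ν x ≤ u} = _
  rcases lt_or_ge u 0 with hu0 | hu0
  · have h1 : {x | cdf ν x ≤ u} = ∅ := by
      ext x
      simpa using hu0.trans_le (cdf_nonneg ν x)
    have h2 : Iic u ∩ Ioc (0:ℝ) 1 = ∅ := by
      ext x
      simp only [mem_inter_iff, mem_Iic, mem_Ioc, mem_empty_iff_false, iff_false]
      intro h
      linarith [h.1, h.2.1]
    rw [h1, h2, measure_empty, measure_empty]
  rcases lt_or_ge u 1 with hu1 | hu1
  · have h2 : Iic u ∩ Ioc (0:ℝ) 1 = Ioc 0 u := by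
      ext x
      simp only [mem_inter_iff, mem_Iic, mem_Ioc]
      exact ⟨fun h => ⟨h.2.1, h.1⟩, fun h => ⟨h.2, h.1, h.2.trans hu1.le⟩⟩
    rw [h2, Real.volume_Ioc, sub_zero, ← ofReal_measureReal]
    congr 1
    refine le_antisymm (hupper u hu0 hu1) ?_
    rcases hu0.eq_or_lt with rfl | hu0
    · exact measureReal_nonneg
    · exact hlower u ⟨hu0, hu1⟩
  · have h1 : {x | cdf ν x ≤ u} = univ := by
      ext x
      simpa using (cdf_le_one ν x).trans hu1
    have h2 : Iic u ∩ Ioc (0:ℝ) 1 = Ioc 0 1 := by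
      ext x
      simp only [mem_inter_iff, mem_Iic, mem_Ioc]
      exact ⟨fun h => h.2, fun h => ⟨h.2.trans hu1, h⟩⟩
    rw [h1, h2, Real.volume_Ioc, measure_univ]
    simp

/-- Among the random variables whose law has density at most one, the uniform distribution on
`[0,1]` minimizes the expected power of the distance between two independent copies. -/
lemma le_integral_integral_abs_sub_rpow {Ω : Type*} [MeasurableSpace Ω] (μ : Measure Ω)
    [IsProbabilityMeasure μ] {X : Ω → ℝ} (hX : Measurable X) {C : ℝ} (hC : ∀ᵐ s ∂μ, |X s| ≤ C)
    (hlaw : ∀ a b, a ≤ b → μ.real (X ⁻¹' Ioc a b) ≤ b - a) {p : ℝ} (hp : 0 < p) :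
    2 / ((p + 1) * (p + 2)) ≤ ∫ s, ∫ t, |X t - X s| ^ p ∂μ ∂μ := by
  set ν := μ.map X with hν
  have : IsProbabilityMeasure ν := Measure.isProbabilityMeasure_map hX.aemeasurable
  set F := cdf ν with hFdef
  have hcdf : ∀ a b, a ≤ b → F b - F a ≤ b - a := fun a b hab => by
    refine le_trans (le_of_eq ?_) (hlaw a b hab)
    rw [hFdef, cdf_eq_real, cdf_eq_real,
      ← measureReal_sdiff (Iic_subset_Iic.2 hab) measurableSet_Iic, hν,
      map_measureReal_apply hX (measurableSet_Iic.diff measurableSet_Iic)]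
    congr 2
    ext x
    simp [and_comm]
  have habs : ∀ a b, |F b - F a| ≤ |b - a| := fun a b => by
    rcases le_total a b with hab | hab
    · rw [abs_of_nonneg (sub_nonneg.2 (monotone_cdf ν hab)), abs_of_nonneg (sub_nonneg.2 hab)]
      exact hcdf a b hab
    · rw [abs_sub_comm (F b), abs_sub_comm b, abs_of_nonneg (sub_nonneg.2 (monotone_cdf ν hab)),
        abs_of_nonneg (sub_nonneg.2 hab)]
      exact hcdf b a hab
  have hF : Continuous F := (LipschitzWith.of_dist_le_mul (K := 1) fun a b => by
    simpa [Real.dist_eq] using habs b a).continuous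
  have hmap : μ.map (fun s => F (X s)) = volume.restrict (Ioc (0:ℝ) 1) := by
    rw [← map_cdf_eq_volume_restrict ν hF, hν, Measure.map_map hF.measurable hX]
    rfl
  have hFX : Measurable fun s => F (X s) := hF.measurable.comp hX
  have hk : ∀ u : ℝ, Continuous fun v : ℝ => |v - u| ^ p := fun u => by
    fun_prop (disch := positivity)
  have hkm : Measurable fun z : ℝ × ℝ => |z.2 - z.1| ^ p := by fun_prop
  have hk2 : StronglyMeasurable fun u : ℝ => ∫ v in Ioc (0:ℝ) 1, |v - u| ^ p :=
    hkm.stronglyMeasurable.integral_prod_right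
  have huniform : 2 / ((p + 1) * (p + 2)) = ∫ s, ∫ t, |F (X t) - F (X s)| ^ p ∂μ ∂μ := by
    rw [← integral_integral_abs_sub_rpow hp]
    simp only [intervalIntegral.integral_of_le zero_le_one]
    have hinner : ∀ u, ∫ v in Ioc (0:ℝ) 1, |v - u| ^ p = ∫ t, |F (X t) - u| ^ p ∂μ := fun u => by
      rw [← hmap, integral_map hFX.aemeasurable (hk u).aestronglyMeasurable]
    simp only [← hinner]
    rw [← integral_map (f := fun u => ∫ v in Ioc (0:ℝ) 1, |v - u| ^ p) hFX.aemeasurable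
      hk2.aestronglyMeasurable, hmap]
  have hbound : ∀ Y : Ω → ℝ, Measurable Y → ∀ B, (∀ᵐ s ∂μ, |Y s| ≤ B) →
      Integrable (fun z : Ω × Ω => |Y z.2 - Y z.1| ^ p) (μ.prod μ) := fun Y hY B hB => by
    refine Integrable.of_bound (by fun_prop (disch := positivity)) ((2 * B) ^ p) ?_
    have h1 : ∀ᵐ z ∂μ.prod μ, |Y z.1| ≤ B := Measure.quasiMeasurePreserving_fst.ae hB
    have h2 : ∀ᵐ z ∂μ.prod μ, |Y z.2| ≤ B := Measure.quasiMeasurePreserving_snd.ae hB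
    filter_upwards [h1, h2] with z hz1 hz2
    rw [Real.norm_of_nonneg (by positivity)]
    refine Real.rpow_le_rpow (abs_nonneg _) ?_ hp.le
    linarith [abs_sub (Y z.2) (Y z.1)]
  have hi1 := hbound X hX C hC
  have hi2 := hbound (fun s => F (X s)) hFX 1 (Filter.Eventually.of_forall fun s => by
    rw [abs_of_nonneg (cdf_nonneg ν _)]
    exact cdf_le_one ν _)
  rw [huniform, ← integral_prod _ hi1, ← integral_prod _ hi2]
  exact integral_mono hi2 hi1 fun z => Real.rpow_le_rpow (abs_nonneg _) (habs _ _) hp.le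

lemma fract_disc_add (N : ℕ) (x : Fin N → ℝ) (t c : ℝ) :
    Int.fract (disc N x t + c) = Int.fract (c - N * t) := by
  have hsum : ∃ k : ℤ, ∑ n : Fin N, (Ico (0:ℝ) t).indicator (fun _ => (1:ℝ)) (x n) = k := by
    classical
    refine ⟨∑ n : Fin N, if x n ∈ Ico (0:ℝ) t then 1 else 0, ?_⟩
    simp [indicator_apply]
  obtain ⟨k, hk⟩ := hsum
  rw [disc, hk, show (k : ℝ) - N * t + c = c - N * t + k by ring, Int.fract_add_intCast]

lemma measurable_disc (N : ℕ) (x : Fin N → ℝ) : Measurable (disc N x) := by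
  classical
  unfold disc
  refine Measurable.sub (Finset.measurable_sum _ fun n _ => ?_) (by fun_prop)
  simp only [indicator_apply, mem_Ico]
  exact Measurable.ite ((MeasurableSet.const _).inter measurableSet_Ioi)
    measurable_const measurable_const

lemma abs_disc_le (N : ℕ) (x : Fin N → ℝ) {t : ℝ} (ht : t ∈ Icc (0:ℝ) 1) :
    |disc N x t| ≤ N := by
  have h0 : 0 ≤ ∑ n : Fin N, (Ico (0:ℝ) t).indicator (fun _ => (1:ℝ)) (x n) :=
    Finset.sum_nonneg fun n _ => indicator_nonneg (fun _ _ => zero_le_one) _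
  have h1 : ∑ n : Fin N, (Ico (0:ℝ) t).indicator (fun _ => (1:ℝ)) (x n) ≤ N := by
    refine (Finset.sum_le_sum fun n _ =>
      indicator_le_self' (fun _ _ => zero_le_one) (x n)).trans ?_
    simp
  have hNt : (N : ℝ) * t ≤ N := mul_le_of_le_one_right N.cast_nonneg ht.2
  have hNt0 : 0 ≤ (N : ℝ) * t := mul_nonneg N.cast_nonneg ht.1
  rw [disc, abs_le]
  constructor <;> linarith

/-- The law of the discrepancy function has density at most one. -/
lemma volume_disc_preimage_Ioc_le {N : ℕ} (hN : 1 ≤ N) (x : Fin N → ℝ) {a b : ℝ} (hab : a ≤ b) :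
    (volume.restrict (Ioc (0:ℝ) 1)).real (disc N x ⁻¹' Ioc a b) ≤ b - a := by
  have : IsProbabilityMeasure (volume.restrict (Ioc (0:ℝ) 1)) := ⟨by simp⟩
  rcases le_or_gt 1 (b - a) with h | h
  · exact measureReal_le_one.trans h
  have hmeas : MeasurableSet {t : ℝ | Int.fract (-a - N * t) ≤ b - a} :=
    measurableSet_le (by fun_prop) measurable_const
  have hsub : disc N x ⁻¹' Ioc a b ⊆ {t : ℝ | Int.fract (-a - N * t) ≤ b - a} := fun t ht => by
    obtain ⟨ht1, ht2⟩ := ht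
    rw [mem_ofPred_eq, ← fract_disc_add N x, Int.fract_eq_self.2 ⟨by linarith, by linarith⟩]
    linarith
  refine (measureReal_mono hsub).trans ?_
  have hint : IntervalIntegrable ((Iic (b - a)).indicator (1 : ℝ → ℝ)) volume 0 1 := by
    rw [intervalIntegrable_iff_integrableOn_Ioc_of_le zero_le_one]
    exact (integrable_const (1:ℝ)).indicator measurableSet_Iic
  have key := integral_comp_fract_sub_nat_mul hN (-a) hint
  rw [intervalIntegral.integral_of_le zero_le_one, intervalIntegral.integral_of_le zero_le_one,
    integral_indicator_one measurableSet_Iic] at key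
  have hl : (fun t : ℝ => (Iic (b - a)).indicator (1 : ℝ → ℝ) (Int.fract (-a - N * t))) =
      {t : ℝ | Int.fract (-a - N * t) ≤ b - a}.indicator 1 := rfl
  rw [hl, integral_indicator_one hmeas] at key
  rw [key, measureReal_restrict_apply measurableSet_Iic]
  have hIoc : Iic (b - a) ∩ Ioc (0:ℝ) 1 ⊆ Ioc 0 (b - a) := fun s hs => ⟨hs.2.1, hs.1⟩
  refine (measureReal_mono hIoc (by simp)).trans ?_
  rw [Real.volume_real_Ioc_of_le (by linarith), sub_zero]

/-- The centred regular grid. -/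
noncomputable def centredGrid (N : ℕ) (n : Fin N) : ℝ := (2 * (n : ℝ) + 1) / (2 * N)

lemma centredGrid_mem (N : ℕ) (n : Fin N) : centredGrid N n ∈ Icc (0:ℝ) 1 := by
  have hn : (n : ℝ) + 1 ≤ N := by exact_mod_cast n.2
  have hN : (0:ℝ) < N := by linarith [(Nat.cast_nonneg n : (0:ℝ) ≤ (n : ℕ))]
  refine ⟨by unfold centredGrid; positivity, ?_⟩
  rw [centredGrid, div_le_one (by positivity)]
  linarith

lemma disc_centredGrid {N : ℕ} (hN : 1 ≤ N) {t : ℝ} (ht : t ∈ Icc (0:ℝ) 1) :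
    disc N (centredGrid N) t = Int.fract (1 / 2 - N * t) - 1 / 2 := by
  classical
  have hN0 : (0:ℝ) < N := by positivity
  set m := ⌈(N : ℝ) * t - 1 / 2⌉₊ with hm
  have hmN : m ≤ N := Nat.ceil_le.2 (by nlinarith [ht.2])
  have hmem : ∀ n : Fin N, centredGrid N n ∈ Ico (0:ℝ) t ↔ (n : ℕ) < m := fun n => by
    rw [hm, Nat.lt_ceil, mem_Ico, and_iff_right (centredGrid_mem N n).1, centredGrid,
      div_lt_iff₀ (by positivity)]
    constructor <;> intro h <;> linarith
  have hcount : ∑ n : Fin N, (Ico (0:ℝ) t).indicator (fun _ => (1:ℝ)) (centredGrid N n) = m := by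
    simp only [indicator_apply, hmem]
    rw [Fin.sum_univ_eq_sum_range (fun n : ℕ => if n < m then (1:ℝ) else 0) N, Finset.sum_boole]
    congr 1
    rw [show (Finset.range N).filter (fun n => n < m) = Finset.range m by
      ext n; simp only [Finset.mem_filter, Finset.mem_range]; omega, Finset.card_range]
  have hceil : (m : ℝ) = -(⌊1 / 2 - (N : ℝ) * t⌋ : ℝ) := by
    have h1 : ((m : ℤ)) = ⌈(N : ℝ) * t - 1 / 2⌉ := by
      refine Int.natCast_ceil_eq_ceil_of_neg_one_lt ?_
      nlinarith [ht.1]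
    have h2 : ⌊1 / 2 - (N : ℝ) * t⌋ = -⌈(N : ℝ) * t - 1 / 2⌉ := by
      rw [← Int.floor_neg, neg_sub]
    rw [h2, ← h1]
    simp
  rw [disc, hcount, hceil, Int.fract]
  ring

theorem minimal_Lp_discrepancy (N : ℕ) (hN : 1 ≤ N) (p : ℝ) (hp : 0 < p) :
    (⨅ x : {x : Fin N → ℝ // ∀ n, x n ∈ Set.Icc (0:ℝ) 1},
        ∫ t in (0:ℝ)..1, |disc N x.1 t| ^ p) = 1 / (2 ^ p * (p + 1)) ∧
    (⨅ x : {x : Fin N → ℝ // ∀ n, x n ∈ Set.Icc (0:ℝ) 1},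
        ∫ t₁ in (0:ℝ)..1, ∫ t₂ in (0:ℝ)..1, |disc2 N x.1 t₁ t₂| ^ p) =
      2 / ((p + 1) * (p + 2)) := by
  have hprob : IsProbabilityMeasure (volume.restrict (Ioc (0:ℝ) 1)) := ⟨by simp⟩
  let g : {x : Fin N → ℝ // ∀ n, x n ∈ Set.Icc (0:ℝ) 1} := ⟨centredGrid N, centredGrid_mem N⟩
  have : Nonempty {x : Fin N → ℝ // ∀ n, x n ∈ Set.Icc (0:ℝ) 1} := ⟨g⟩
  have hgrid : ∀ t ∈ uIcc (0:ℝ) 1,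
      disc N (centredGrid N) t = Int.fract (1 / 2 - N * t) - 1 / 2 := fun t ht => by
    rw [uIcc_of_le zero_le_one] at ht
    exact disc_centredGrid hN ht
  have hk : ∀ u : ℝ, Continuous fun v : ℝ => |v - u| ^ p := fun u => by
    fun_prop (disch := positivity)
  have hhalf := integral_comp_fract_sub_nat_mul hN (1 / 2) ((hk (1 / 2)).intervalIntegrable 0 1)
  rw [integral_abs_sub_half_rpow hp] at hhalf
  constructor
  · apply le_antisymm
    · refine (ciInf_le ⟨0, ?_⟩ g).trans (le_of_eq ?_)
      · rintro _ ⟨x, rfl⟩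
        exact intervalIntegral.integral_nonneg zero_le_one fun t _ => by positivity
      · rw [← hhalf]
        refine intervalIntegral.integral_congr fun t ht => ?_
        simp only [g, hgrid t ht]
    · refine le_ciInf fun x => ?_
      have hle : ∀ t : ℝ, |Int.fract (1 / 2 - N * t) - 1 / 2| ≤ |disc N x.1 t| := fun t => by
        have h := round_le (disc N x.1 t) 0
        rw [round_eq, Int.cast_zero, sub_zero] at h
        rwa [← fract_disc_add N x.1, Int.fract, sub_right_comm, add_sub_cancel_right]
      have hi : ∀ Y : ℝ → ℝ, Measurable Y → (∀ t ∈ Icc (0:ℝ) 1, |Y t| ≤ N) →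
          IntervalIntegrable (fun t => |Y t| ^ p) volume 0 1 := fun Y hY hB => by
        rw [intervalIntegrable_iff_integrableOn_Ioc_of_le zero_le_one]
        refine Integrable.of_bound (by fun_prop (disch := positivity)) ((N : ℝ) ^ p) ?_
        filter_upwards [ae_restrict_mem measurableSet_Ioc] with t ht
        rw [Real.norm_of_nonneg (by positivity)]
        exact Real.rpow_le_rpow (abs_nonneg _) (hB t ⟨ht.1.le, ht.2⟩) hp.le
      rw [← hhalf]
      refine intervalIntegral.integral_mono_on zero_le_one
        (hi _ (by fun_prop) fun t ht => (hle t).trans (abs_disc_le N x.1 ht))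
        (hi _ (measurable_disc N x.1) fun t ht => abs_disc_le N x.1 ht) fun t _ =>
          Real.rpow_le_rpow (abs_nonneg _) (hle t) hp.le
  · apply le_antisymm
    · refine (ciInf_le ⟨0, ?_⟩ g).trans (le_of_eq ?_)
      · rintro _ ⟨x, rfl⟩
        exact intervalIntegral.integral_nonneg zero_le_one fun s _ =>
          intervalIntegral.integral_nonneg zero_le_one fun t _ => by positivity
      · have hinner : ∀ s ∈ uIcc (0:ℝ) 1,
            ∫ t in (0:ℝ)..1, |disc2 N (centredGrid N) s t| ^ p =
              ∫ v in (0:ℝ)..1, |v - Int.fract (1 / 2 - N * s)| ^ p := fun s hs => by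
          rw [← integral_comp_fract_sub_nat_mul hN (1 / 2)
            ((hk (Int.fract (1 / 2 - N * s))).intervalIntegrable 0 1)]
          refine intervalIntegral.integral_congr fun t ht => ?_
          simp only [disc2, hgrid t ht, hgrid s hs, sub_sub_sub_cancel_right]
        have hkc : Continuous fun u : ℝ => ∫ v in (0:ℝ)..1, |v - u| ^ p :=
          intervalIntegral.continuous_parametric_intervalIntegral_of_continuous'
            (by fun_prop (disch := positivity)) 0 1
        rw [← integral_integral_abs_sub_rpow hp,
          ← integral_comp_fract_sub_nat_mul hN (1 / 2) (hkc.intervalIntegrable 0 1)]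
        exact intervalIntegral.integral_congr hinner
    · refine le_ciInf fun x => ?_
      simp only [intervalIntegral.integral_of_le zero_le_one]
      exact le_integral_integral_abs_sub_rpow _ (measurable_disc N x.1)
        ((ae_restrict_mem measurableSet_Ioc).mono fun t ht =>
          abs_disc_le N x.1 ⟨ht.1.le, ht.2⟩)
        (fun a b hab => volume_disc_preimage_Ioc_le hN x.1 hab) hp
end
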